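/- arXiv:1905.10645 — 2 statements merged into one kernel-verified Lean document; each statement's English description precedes it below -/
import Mathlib

section
/- Let n ≥ 3 and p be real. For the function Ω(x) = x^{p/2} on x > 0, the pair of ODEs ∂ₓ²f + ((n-2)/2)(∂ₓ²Ω/Ω)f = 0 and Ω∂ₓΩ∂ₓf + (1/2)((n-3)(∂ₓΩ)² + Ω∂ₓ²Ω)f = 0 admits a nontrivial common solution f(x) = f₀·x^{(2-(n-2)p)/4} (f₀ ≠ 0) if and only if p = (2/n)(1 ± √(2(n-1)/(n-2))). -/
theorem d1 (c a x : ℝ) (hx : 0 < x) :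
    deriv (fun y : ℝ => c * y ^ a) x = c * a * x ^ a / x := by
  have h := ((Real.hasDerivAt_rpow_const (x := x) (p := a) (Or.inl hx.ne')).const_mul c).deriv
  rw [h, Real.rpow_sub_one hx.ne']
  ring

theorem d2 (c a x : ℝ) (hx : 0 < x) :
    deriv (deriv (fun y : ℝ => c * y ^ a)) x = c * a * (a - 1) * x ^ a / x ^ 2 := by
  have h : deriv (fun y : ℝ => c * y ^ a) =ᶠ[nhds x] fun y => (c * a) * y ^ (a - 1) := by
    filter_upwards [lt_mem_nhds hx] with y hy
    rw [d1 c a y hy, Real.rpow_sub_one hy.ne']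
    ring
  rw [h.deriv_eq, d1 _ _ x hx, Real.rpow_sub_one hx.ne']
  field_simp

theorem d1' (a x : ℝ) (hx : 0 < x) :
    deriv (fun y : ℝ => y ^ a) x = a * x ^ a / x := by
  simpa using d1 1 a x hx

theorem d2' (a x : ℝ) (hx : 0 < x) :
    deriv (deriv (fun y : ℝ => y ^ a)) x = a * (a - 1) * x ^ a / x ^ 2 := by
  simpa using d2 1 a x hx

theorem alg (N p : ℝ) (hN : 3 ≤ N) :
    (p = 2 / N * (1 + Real.sqrt (2 * (N - 1) / (N - 2)))
        ∨ p = 2 / N * (1 - Real.sqrt (2 * (N - 1) / (N - 2)))) ↔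
      (N - 2) * N * p ^ 2 - 4 * (N - 2) * p - 4 = 0 := by
  have h2 : 0 < N - 2 := by linarith
  have h0 : 0 < N := by linarith
  have hs : Real.sqrt (2 * (N - 1) / (N - 2)) ^ 2 = 2 * (N - 1) / (N - 2) :=
    Real.sq_sqrt (div_nonneg (by linarith) h2.le)
  set s := Real.sqrt (2 * (N - 1) / (N - 2))
  have hs' : (N - 2) * s ^ 2 = 2 * (N - 1) := by rw [hs]; field_simp
  have key : N * ((N - 2) * N * p ^ 2 - 4 * (N - 2) * p - 4)
      = (N - 2) * ((N * p - 2 * (1 + s)) * (N * p - 2 * (1 - s))) := by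
    linear_combination 4 * hs'
  have e (t : ℝ) : p = 2 / N * t ↔ N * p - 2 * t = 0 := by
    rw [sub_eq_zero, div_mul_eq_mul_div, eq_div_iff h0.ne', mul_comm p]
  rw [e, e, ← mul_eq_zero]
  constructor
  · intro h
    rw [h, mul_zero] at key
    exact (mul_eq_zero.mp key).resolve_left h0.ne'
  · intro h
    rw [h, mul_zero] at key
    exact (mul_eq_zero.mp key.symm).resolve_left h2.ne'

/-- For `Ω(x) = x^{p/2}` on `x > 0`, the ODE system
`∂ₓ²f + ((n-2)/2)(∂ₓ²Ω/Ω)f = 0` and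
`Ω∂ₓΩ∂ₓf + (1/2)((n-3)(∂ₓΩ)² + Ω∂ₓ²Ω)f = 0`
admits the nontrivial common solution `f(x) = f₀·x^{(2-(n-2)p)/4}` (`f₀ ≠ 0`)
if and only if `p = (2/n)(1 ± √(2(n-1)/(n-2)))`. -/
theorem stmt4 (n : ℕ) (hn : 3 ≤ n) (p f₀ : ℝ) (hf₀ : f₀ ≠ 0) :
    (∀ x : ℝ, 0 < x →
      (deriv (deriv (fun y : ℝ => f₀ * y ^ ((2 - ((n : ℝ) - 2) * p) / 4))) x
          + ((n : ℝ) - 2) / 2 * (deriv (deriv (fun y : ℝ => y ^ (p / 2))) x / x ^ (p / 2))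
            * (f₀ * x ^ ((2 - ((n : ℝ) - 2) * p) / 4)) = 0) ∧
      (x ^ (p / 2) * deriv (fun y : ℝ => y ^ (p / 2)) x
            * deriv (fun y : ℝ => f₀ * y ^ ((2 - ((n : ℝ) - 2) * p) / 4)) x
          + (1 / 2) * (((n : ℝ) - 3) * (deriv (fun y : ℝ => y ^ (p / 2)) x) ^ 2
              + x ^ (p / 2) * deriv (deriv (fun y : ℝ => y ^ (p / 2))) x)
            * (f₀ * x ^ ((2 - ((n : ℝ) - 2) * p) / 4)) = 0))
    ↔ (p = 2 / (n : ℝ) * (1 + Real.sqrt (2 * ((n : ℝ) - 1) / ((n : ℝ) - 2)))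
        ∨ p = 2 / (n : ℝ) * (1 - Real.sqrt (2 * ((n : ℝ) - 1) / ((n : ℝ) - 2)))) := by
  have hN : (3 : ℝ) ≤ n := by exact_mod_cast hn
  rw [alg _ p hN]
  constructor
  · intro h
    have h1 := (h 1 one_pos).1
    rw [d2 _ _ _ one_pos, d2' _ _ one_pos] at h1
    simp only [Real.one_rpow, one_pow, div_one, mul_one] at h1
    apply mul_left_cancel₀ hf₀
    linear_combination 16 * h1
  · intro h x hx
    have hp := Real.rpow_pos_of_pos hx (p / 2)
    rw [d2 _ _ _ hx, d2' _ _ hx, d1 _ _ _ hx, d1' _ _ hx]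
    generalize x ^ (p / 2) = A at *
    generalize x ^ ((2 - ((n : ℝ) - 2) * p) / 4) = B at *
    constructor
    · have e : A ≠ 0 := hp.ne'
      have e2 : p / 2 * (p / 2 - 1) * A / x ^ 2 / A = p / 2 * (p / 2 - 1) / x ^ 2 := by
        field_simp
      rw [e2]
      linear_combination f₀ * B / x ^ 2 / 16 * h
    · ring
end

section
/- Let S = ℝ^{n-1} with the flat metric (n ≥ 3). The system consisting of (i) Δf = 0 on S, (ii) the transport equation (∂_v - (2/(n-1))θ(v))η_A - 2π_A{}^B(v)η_B = -∂_A f along v with η_A(0) = 0, where θ and π_A{}^B depend only on v, and (iii) the compatibility condition (∂_{(A}η_{B)})_{tracefree} = 0, admits exactly n linearly independent solutions f, namely f = 1 and f = x^A for A = 1,…,n-1; each such f gives η_A independent of the x-coordinates, so (iii) holds automatically. -/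
noncomputable section

/-- Partial derivative `∂_A f` in flat coordinates. -/
def pd {d : ℕ} (f : EuclideanSpace ℝ (Fin d) → ℝ) (A : Fin d)
    (x : EuclideanSpace ℝ (Fin d)) : ℝ :=
  fderiv ℝ f x (EuclideanSpace.single A 1)

/-- Flat Laplacian `Δf = Σ_A ∂_A∂_A f`. -/
def lap {d : ℕ} (f : EuclideanSpace ℝ (Fin d) → ℝ) (x : EuclideanSpace ℝ (Fin d)) : ℝ :=
  ∑ A, pd (fun y => pd f A y) A x

/-- The system of Proposition 6.3 on flat `S = ℝ^{n-1}`: (i) `Δf = 0`;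
(ii) the transport equation `(∂_v - (2/(n-1))θ)η_A - 2π_A{}^B η_B = -∂_A f` with
`η_A(0) = 0`; (iii) the compatibility `(∂_{(A}η_{B)})_{tf} = 0`. -/
def IsSol (n : ℕ) (θ : ℝ → ℝ) (π : ℝ → Fin (n - 1) → Fin (n - 1) → ℝ)
    (f : EuclideanSpace ℝ (Fin (n - 1)) → ℝ)
    (η : ℝ → EuclideanSpace ℝ (Fin (n - 1)) → Fin (n - 1) → ℝ) : Prop :=
  ContDiff ℝ (⊤ : ℕ∞) f ∧
  (∀ x, lap f x = 0) ∧
  (∀ v x A, HasDerivAt (fun t => η t x A)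
      ((2 / ((n : ℝ) - 1)) * θ v * η v x A + 2 * ∑ B, π v A B * η v x B - pd f A x) v) ∧
  (∀ x A, η 0 x A = 0) ∧
  (∀ v x A B, (pd (fun y => η v y B) A x + pd (fun y => η v y A) B x) / 2
      - (if A = B then (1 : ℝ) else 0) * (∑ C, pd (fun y => η v y C) C x) / ((n : ℝ) - 1)
      = 0)

section ODE
set_option linter.unusedSectionVars false
variable {E : Type*} [NormedAddCommGroup E] [NormedSpace ℝ E] [CompleteSpace E]

noncomputable def picIter (A : ℝ → E →L[ℝ] E) (b : E) : ℕ → ℝ → E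
  | 0 => fun v => v • b
  | k + 1 => fun v => ∫ s in (0 : ℝ)..v, A s (picIter A b k s)

noncomputable def picDer (A : ℝ → E →L[ℝ] E) (b : E) : ℕ → ℝ → E
  | 0 => fun _ => b
  | k + 1 => fun v => A v (picIter A b k v)

lemma picIter_zero (A : ℝ → E →L[ℝ] E) (b : E) (k : ℕ) : picIter A b k 0 = 0 := by
  cases k <;> simp [picIter]

lemma picIter_hasDeriv (A : ℝ → E →L[ℝ] E) (hA : Continuous A) (b : E) (k : ℕ) :
    ∀ v, HasDerivAt (picIter A b k) (picDer A b k v) v := by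
  induction k with
  | zero =>
    intro v
    simpa [picIter, picDer] using (hasDerivAt_id v).smul_const b
  | succ k ih =>
    intro v
    have hc : Continuous (picIter A b k) :=
      continuous_iff_continuousAt.2 fun v => (ih v).continuousAt
    exact ((hA.clm_apply hc).integral_hasStrictDerivAt 0 v).hasDerivAt

lemma picIter_bound (A : ℝ → E →L[ℝ] E) (b : E) (T C : ℝ)
    (hC0 : 0 ≤ C) (hC : ∀ v, |v| ≤ T → ‖A v‖ ≤ C) (k : ℕ) :
    ∀ v, |v| ≤ T → ‖picIter A b k v‖ ≤ T * ‖b‖ * (C ^ k * |v| ^ k / k.factorial) := by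
  induction k with
  | zero =>
    intro v hv
    simp only [picIter, norm_smul, Real.norm_eq_abs]
    simpa using mul_le_mul_of_nonneg_right hv (norm_nonneg b)
  | succ k ih =>
    intro v hv
    have hT : 0 ≤ T := (abs_nonneg v).trans hv
    have h1 : ‖∫ s in (0 : ℝ)..v, A s (picIter A b k s)‖ ≤
        |∫ s in (0 : ℝ)..v, (C * (T * ‖b‖ * C ^ k / k.factorial)) * |s - 0| ^ k| := by
      apply intervalIntegral.norm_integral_le_abs_of_norm_le
      · refine (MeasureTheory.ae_restrict_iff' measurableSet_uIoc).2 (Filter.Eventually.of_forall ?_)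
        intro s hs
        have hs' : |s| ≤ T := by
          rcases Set.mem_uIoc.1 hs with h | h
          · rw [abs_of_pos h.1]; exact h.2.trans ((le_abs_self v).trans hv)
          · rw [abs_of_nonpos h.2]; linarith [neg_abs_le v]
        calc ‖A s (picIter A b k s)‖ ≤ ‖A s‖ * ‖picIter A b k s‖ := (A s).le_opNorm _
          _ ≤ C * (T * ‖b‖ * (C ^ k * |s| ^ k / k.factorial)) := by
              gcongr
              · exact hC s hs'
              · exact ih s hs'
          _ = _ := by rw [sub_zero]; ring
      · apply Continuous.intervalIntegrable
        fun_prop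
    refine h1.trans (le_of_eq ?_)
    rw [intervalIntegral.integral_const_mul, abs_mul, intervalIntegral.abs_intervalIntegral_eq,
      integral_pow_abs_sub_uIoc, abs_of_nonneg (by positivity), abs_of_nonneg (by positivity),
      sub_zero, Nat.factorial_succ]
    push_cast
    field_simp
    ring

lemma exists_bound (A : ℝ → E →L[ℝ] E) (hA : Continuous A) (T : ℝ) :
    ∃ C : ℝ, 0 ≤ C ∧ ∀ v, |v| ≤ T → ‖A v‖ ≤ C := by
  obtain ⟨C, hC⟩ := (isCompact_Icc (a := -T) (b := T)).exists_bound_of_continuousOn hA.continuousOn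
  exact ⟨max C 0, le_max_right _ _, fun v hv => (hC v (abs_le.1 hv)).trans (le_max_left _ _)⟩

lemma linear_ode_exists (A : ℝ → E →L[ℝ] E) (hA : Continuous A) (b : E) :
    ∃ y : ℝ → E, y 0 = 0 ∧ ∀ v, HasDerivAt y (A v (y v) + b) v := by
  refine ⟨fun v => ∑' k, picIter A b k v, by simp [picIter_zero], fun v => ?_⟩
  set T := |v| + 1 with hTdef
  have hT : 0 ≤ T := by positivity
  obtain ⟨C, hC0, hC⟩ := exists_bound A hA T
  set u : ℕ → ℝ := fun k => T * ‖b‖ * ((C * T) ^ k / k.factorial) with hu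
  have hus : Summable u := (Real.summable_pow_div_factorial (C * T)).mul_left _
  have hgb : ∀ k w, |w| ≤ T → ‖picIter A b k w‖ ≤ u k := by
    intro k w hw
    refine (picIter_bound A b T C hC0 hC k w hw).trans ?_
    simp only [hu]
    rw [mul_pow]
    gcongr
  set u' : ℕ → ℝ := fun k => match k with
    | 0 => ‖b‖
    | k + 1 => C * u k with hu'
  have hus' : Summable u' := (summable_nat_add_iff 1).1 (hus.mul_left C)
  have hder : ∀ k w, |w| ≤ T → ‖picDer A b k w‖ ≤ u' k := by
    intro k w hw
    cases k with
    | zero => exact le_rfl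
    | succ k =>
      refine ((A w).le_opNorm _).trans ?_
      exact mul_le_mul (hC w hw) (hgb k w hw) (norm_nonneg _) hC0
  have hv : v ∈ Set.Ioo (-T) T := by
    rw [Set.mem_Ioo, ← abs_lt]; linarith
  have hmem : ∀ w ∈ Set.Ioo (-T) T, |w| ≤ T := fun w hw => (abs_lt.2 hw).le
  have key := hasDerivAt_tsum_of_isPreconnected (g := picIter A b) (g' := picDer A b) hus'
    isOpen_Ioo isPreconnected_Ioo (fun k w _ => picIter_hasDeriv A hA b k w)
    (fun k w hw => hder k w (hmem w hw)) hv
    (Summable.of_norm_bounded hus fun k => hgb k v (hmem v hv)) hv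
  convert key using 1
  have hs : Summable fun k => picIter A b k v := .of_norm_bounded hus fun k => hgb k v (hmem v hv)
  have hs' : Summable fun k => picDer A b k v := .of_norm_bounded hus' fun k => hder k v (hmem v hv)
  rw [hs'.tsum_eq_zero_add, (A v).map_tsum hs, add_comm]
  rfl

lemma linear_ode_unique (A : ℝ → E →L[ℝ] E) (hA : Continuous A) (b : E) (y z : ℝ → E)
    (h0 : y 0 = z 0) (hy : ∀ v, HasDerivAt y (A v (y v) + b) v)
    (hz : ∀ v, HasDerivAt z (A v (z v) + b) v) (v : ℝ) : y v = z v := by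
  obtain ⟨C, hC0, hC⟩ := exists_bound A hA (|v| + 1)
  have hv : v ∈ Set.Ioo (-(|v| + 1)) (|v| + 1) := by
    rw [Set.mem_Ioo, ← abs_lt]; linarith
  refine ODE_solution_unique_of_mem_Ioo (v := fun t x => A t x + b) (s := fun _ => Set.univ)
    (K := ⟨C, hC0⟩) (t₀ := 0) ?_ ?_ (fun t _ => ⟨hy t, trivial⟩) (fun t _ => ⟨hz t, trivial⟩) h0 hv
  · intro t ht
    refine LipschitzOnWith.of_dist_le_mul fun x _ w _ => ?_
    rw [dist_add_right, dist_eq_norm, dist_eq_norm, ← map_sub]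
    refine ((A t).le_opNorm _).trans ?_
    exact mul_le_mul_of_nonneg_right (hC t (abs_lt.2 ht).le) (norm_nonneg _)
  · constructor <;> linarith [abs_nonneg v]
end ODE

section Main

def shearOp {d : ℕ} (c : ℝ → ℝ) (π : ℝ → Fin d → Fin d → ℝ) (v : ℝ) :
    (Fin d → ℝ) →L[ℝ] (Fin d → ℝ) :=
  (c v) • ContinuousLinearMap.id ℝ (Fin d → ℝ) +
    ∑ a, ∑ b, (2 * π v a b) •
      (ContinuousLinearMap.proj (R := ℝ) (φ := fun _ : Fin d => ℝ) b).smulRight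
        (Pi.single a (1 : ℝ) : Fin d → ℝ)

lemma shearOp_apply {d : ℕ} (c : ℝ → ℝ) (π : ℝ → Fin d → Fin d → ℝ) (v : ℝ) (y : Fin d → ℝ)
    (a : Fin d) : shearOp c π v y a = c v * y a + 2 * ∑ b, π v a b * y b := by
  simp [shearOp, Finset.sum_apply, Pi.single_apply, Finset.mul_sum,
    mul_assoc, Finset.sum_ite_irrel]

lemma shearOp_cont {d : ℕ} (c : ℝ → ℝ) (π : ℝ → Fin d → Fin d → ℝ) (hc : Continuous c)
    (hπ : ∀ a b, Continuous fun v => π v a b) : Continuous (shearOp c π) := by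
  unfold shearOp
  refine (hc.smul continuous_const).add ?_
  refine continuous_finsetSum _ fun a _ => continuous_finsetSum _ fun b _ => ?_
  exact (continuous_const.mul (hπ a b)).smul continuous_const

lemma pd_affine {d : ℕ} (c : ℝ) (b : Fin d → ℝ) (A : Fin d) (x : EuclideanSpace ℝ (Fin d)) :
    pd (fun x : EuclideanSpace ℝ (Fin d) => c + ∑ A, b A * x A) A x = b A := by
  have h : HasFDerivAt (fun x : EuclideanSpace ℝ (Fin d) => c + ∑ A, b A * x A)
      (∑ A, b A • (EuclideanSpace.proj A : EuclideanSpace ℝ (Fin d) →L[ℝ] ℝ)) x := by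
    refine HasFDerivAt.const_add c ?_
    refine HasFDerivAt.fun_sum fun i _ => ?_
    exact ((EuclideanSpace.proj i : EuclideanSpace ℝ (Fin d) →L[ℝ] ℝ).hasFDerivAt).const_mul (b i)
  rw [pd, h.fderiv]
  simp [Pi.single_apply]

lemma pd_const {d : ℕ} (c : ℝ) (A : Fin d) (x : EuclideanSpace ℝ (Fin d)) :
    pd (fun _ : EuclideanSpace ℝ (Fin d) => c) A x = 0 := by
  simp [pd]

/-- A linear functional vanishing on the coordinate vectors vanishes. -/
lemma clm_zero {d : ℕ} (L : EuclideanSpace ℝ (Fin d) →L[ℝ] ℝ)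
    (h : ∀ A, L (EuclideanSpace.single A 1) = 0) : L = 0 := by
  apply ContinuousLinearMap.coe_injective
  refine (EuclideanSpace.basisFun (Fin d) ℝ).toBasis.ext fun A => ?_
  simpa using h A

lemma smooth_two {d : ℕ} {f : EuclideanSpace ℝ (Fin d) → ℝ} (hf : ContDiff ℝ (⊤ : ℕ∞) f) :
    ContDiff ℝ 2 f := by
  exact_mod_cast contDiff_infty.1 hf 2

lemma pd_pd_symm {d : ℕ} (f : EuclideanSpace ℝ (Fin d) → ℝ) (hf : ContDiff ℝ (⊤ : ℕ∞) f)
    (A B : Fin d) (x : EuclideanSpace ℝ (Fin d)) :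
    pd (fun y => pd f A y) B x = pd (fun y => pd f B y) A x := by
  have hd : DifferentiableAt ℝ (fderiv ℝ f) x :=
    (((smooth_two hf).fderiv_right (m := 1) (by norm_num)).differentiable (by simp)) x
  have hs : IsSymmSndFDerivAt ℝ f x :=
    (smooth_two hf).contDiffAt.isSymmSndFDerivAt (by simp)
  have e : ∀ A B : Fin d, pd (fun y => pd f A y) B x =
      fderiv ℝ (fderiv ℝ f) x (EuclideanSpace.single B 1) (EuclideanSpace.single A 1) := by
    intro A B
    unfold pd
    rw [fderiv_clm_apply hd (differentiableAt_const _)]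
    simp
  rw [e, e]
  exact hs _ _

lemma pd_diff {d : ℕ} (f : EuclideanSpace ℝ (Fin d) → ℝ) (hf : ContDiff ℝ (⊤ : ℕ∞) f)
    (A : Fin d) : Differentiable ℝ (fun y => pd f A y) := by
  have hd : Differentiable ℝ (fderiv ℝ f) :=
    (((smooth_two hf).fderiv_right (m := 1) (by norm_num)).differentiable (by simp))
  exact hd.clm_apply (differentiable_const _)

lemma affine_of_hess {d : ℕ} (f : EuclideanSpace ℝ (Fin d) → ℝ) (hf : ContDiff ℝ (⊤ : ℕ∞) f)
    (h : ∀ A B x, pd (fun y => pd f A y) B x = 0) :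
    ∃ (c : ℝ) (b : Fin d → ℝ), f = fun x => c + ∑ A, b A * x A := by
  have h1 : ∀ A x, pd f A x = pd f A 0 := fun A x =>
    is_const_of_fderiv_eq_zero (pd_diff f hf A) (fun x => clm_zero _ fun B => h A B x) x 0
  refine ⟨f 0, fun A => pd f A 0, ?_⟩
  have hl : Differentiable ℝ
      (fun x : EuclideanSpace ℝ (Fin d) => f 0 + ∑ A, pd f A 0 * x A) := by fun_prop
  have hfd : Differentiable ℝ f := hf.differentiable (by simp)
  have h2 := is_const_of_fderiv_eq_zero (hfd.sub hl) (fun x => clm_zero _ fun B => by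
    rw [fderiv_sub (hfd x) (hl x)]
    have := pd_affine (f 0) (fun A => pd f A 0) B x
    rw [← h1 B x] at this
    unfold pd at this
    simp only [sub_apply]
    unfold pd
    rw [this, sub_self])
  funext x
  have h3 := h2 x 0
  simp at h3
  linarith

lemma sol_affine (n : ℕ) (θ : ℝ → ℝ) (hθ : ContDiff ℝ (⊤ : ℕ∞) θ)
    (π : ℝ → Fin (n - 1) → Fin (n - 1) → ℝ)
    (hπc : ∀ A B, ContDiff ℝ (⊤ : ℕ∞) fun v => π v A B)
    (f : EuclideanSpace ℝ (Fin (n - 1)) → ℝ)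
    (η : ℝ → EuclideanSpace ℝ (Fin (n - 1)) → Fin (n - 1) → ℝ) (h : IsSol n θ π f η) :
    ∃ (c : ℝ) (b : Fin (n - 1) → ℝ), f = fun x => c + ∑ A, b A * x A := by
  obtain ⟨hf, hlap, hη, hη0, hcomp⟩ := h
  set Op := shearOp (fun v => 2 / ((n : ℝ) - 1) * θ v) π with hOp
  have hOpc : Continuous Op :=
    shearOp_cont _ _ (continuous_const.mul hθ.continuous) fun a b => (hπc a b).continuous
  choose m hm0 hm using fun C : Fin (n - 1) =>
    linear_ode_exists Op hOpc (Pi.single C (1 : ℝ) : Fin (n - 1) → ℝ)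
  have hrep : ∀ v x, η v x = ∑ C, (-pd f C x) • m C v := by
    intro v x
    refine linear_ode_unique Op hOpc (fun A => -pd f A x) (fun v => η v x)
      (fun v => ∑ C, (-pd f C x) • m C v) ?_ ?_ ?_ v
    · funext A; simp [hη0, hm0]
    · intro v
      refine hasDerivAt_pi.2 fun A => ?_
      refine (hη v x A).congr_deriv ?_
      rw [Pi.add_apply, hOp, shearOp_apply]
      ring
    · intro v
      have := HasDerivAt.fun_sum (u := Finset.univ)
        fun C (_ : C ∈ Finset.univ) => (hm C v).const_smul (-pd f C x)
      refine this.congr_deriv ?_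
      rw [map_sum]
      simp only [smul_add, Finset.sum_add_distrib, map_smul]
      congr 1
      funext A
      simp [Finset.sum_apply, Pi.single_apply]
  refine affine_of_hess f hf fun A B x => ?_
  set H : Fin (n - 1) → Fin (n - 1) → ℝ := fun A B => pd (fun y => pd f A y) B x with hH
  have hpd : ∀ v A B, pd (fun y => η v y B) A x = ∑ C, -(H C A) * m C v B := by
    intro v A B
    have e : (fun y => η v y B) = fun y => ∑ C, (-pd f C y) * m C v B := by
      funext y; rw [hrep]; simp [Finset.sum_apply]
    rw [e]
    have hd := HasFDerivAt.fun_sum (u := Finset.univ) (x := x)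
      fun C (_ : C ∈ Finset.univ) => ((pd_diff f hf C x).hasFDerivAt.fun_neg).mul_const (m C v B)
    rw [pd, hd.fderiv]
    simp [hH, pd, mul_comm]
  have hmd : ∀ C B, HasDerivAt (fun v => m C v B) (if B = C then 1 else 0) 0 := by
    intro C B
    have := hasDerivAt_pi.1 (hm C 0) B
    simpa [hm0, Pi.single_apply] using this
  have hpdd : ∀ A B, HasDerivAt (fun v => pd (fun y => η v y B) A x) (-(H B A)) 0 := by
    intro A B
    simp only [hpd]
    have := HasDerivAt.fun_sum (u := Finset.univ)
      fun C (_ : C ∈ Finset.univ) => (hmd C B).const_mul (-(H C A))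
    refine this.congr_deriv ?_
    simp
  have htr : ∑ C, H C C = 0 := hlap x
  have hL : HasDerivAt (fun v => (pd (fun y => η v y B) A x + pd (fun y => η v y A) B x) / 2
      - (if A = B then (1 : ℝ) else 0) * (∑ C, pd (fun y => η v y C) C x) / ((n : ℝ) - 1))
      ((-(H B A) + -(H A B)) / 2 -
        (if A = B then (1 : ℝ) else 0) * (∑ C, -(H C C)) / ((n : ℝ) - 1)) 0 :=
    (((hpdd A B).fun_add (hpdd B A)).div_const 2).fun_sub
      (((HasDerivAt.fun_sum fun C _ => hpdd C C).const_mul _).div_const _)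
  have hz := hL.unique ((hasDerivAt_const (0 : ℝ) (0 : ℝ)).congr_of_eventuallyEq
    (Filter.Eventually.of_forall fun v => hcomp v x A B))
  rw [Finset.sum_neg_distrib, htr] at hz
  have hsym : H B A = H A B := pd_pd_symm f hf B A x
  rw [hsym] at hz
  simp at hz
  change H A B = 0
  linarith

lemma affine_sol (n : ℕ) (θ : ℝ → ℝ) (hθ : ContDiff ℝ (⊤ : ℕ∞) θ)
    (π : ℝ → Fin (n - 1) → Fin (n - 1) → ℝ)
    (hπc : ∀ A B, ContDiff ℝ (⊤ : ℕ∞) fun v => π v A B)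
    (c : ℝ) (b : Fin (n - 1) → ℝ) : ∃ η,
        IsSol n θ π (fun x => c + ∑ A, b A * x A) η ∧ ∀ v x y, η v x = η v y := by
  set Op := shearOp (fun v => 2 / ((n : ℝ) - 1) * θ v) π with hOp
  have hOpc : Continuous Op :=
    shearOp_cont _ _ (continuous_const.mul hθ.continuous) fun a b => (hπc a b).continuous
  obtain ⟨y, hy0, hy⟩ := linear_ode_exists Op hOpc (fun A => -b A)
  refine ⟨fun v _ => y v, ⟨by fun_prop, ?_, ?_, ?_, ?_⟩, fun _ _ _ => rfl⟩
  · intro x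
    simp [lap, pd_affine, pd_const]
  · intro v x A
    have := hasDerivAt_pi.1 (hy v) A
    rw [pd_affine]
    refine this.congr_deriv ?_
    rw [Pi.add_apply, hOp, shearOp_apply]
    ring
  · intro x A; simp [hy0]
  · intro v x A B; simp [pd_const]

end Main

/-- On flat `ℝ^{n-1}` (`n ≥ 3`), with `θ` and the trace-free symmetric shear `π` depending
only on `v`, the system (i)-(iii) admits exactly the affine functions `f = c + Σ b_A x^A`
as solutions (an `n`-dimensional space spanned by `1` and the `x^A`), and for each such `f`
the transport equation has a solution `η` independent of the `x`-coordinates, so that (iii)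
holds automatically. -/
theorem stmt17 (n : ℕ) (hn : 3 ≤ n) (θ : ℝ → ℝ) (hθ : ContDiff ℝ (⊤ : ℕ∞) θ)
    (π : ℝ → Fin (n - 1) → Fin (n - 1) → ℝ)
    (hπsym : ∀ v A B, π v A B = π v B A) (hπtf : ∀ v, ∑ A, π v A A = 0)
    (hπc : ∀ A B, ContDiff ℝ (⊤ : ℕ∞) fun v => π v A B) :
    (∀ f η, IsSol n θ π f η →
        ∃ (c : ℝ) (b : Fin (n - 1) → ℝ), f = fun x => c + ∑ A, b A * x A) ∧
    (∀ (c : ℝ) (b : Fin (n - 1) → ℝ), ∃ η,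
        IsSol n θ π (fun x => c + ∑ A, b A * x A) η ∧ ∀ v x y, η v x = η v y) ∧
    LinearIndependent ℝ (fun o : Option (Fin (n - 1)) =>
      (match o with
        | none => fun _ : EuclideanSpace ℝ (Fin (n - 1)) => (1 : ℝ)
        | some A => fun x : EuclideanSpace ℝ (Fin (n - 1)) => x A)) := by
  refine ⟨fun f η h => sol_affine n θ hθ π hπc f η h, affine_sol n θ hθ π hπc, ?_⟩
  rw [Fintype.linearIndependent_iff]
  intro g hg
  rw [Fintype.sum_option] at hg
  have h0 : g none = 0 := by
    have := congrFun hg 0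
    simpa using this
  have hA : ∀ A, g (some A) = 0 := by
    intro A
    have := congrFun hg (EuclideanSpace.single A 1)
    simpa [h0, Finset.sum_apply, Pi.single_apply] using this
  intro o
  cases o with
  | none => exact h0
  | some A => exact hA A
end
end
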